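/- The element e_{nn}[1] · cdet(τ + E[−1]) − (1/n)(K + n) · ( (n−1) |τ + E[−1]|_{nn} − Σ_{i=1}^{n−1} |τ + E[−1]|_{ii} ) of U lies in the left ideal I of U generated by all e_{kl}[r] with r ≥ 0, where |τ + E[−1]|_{jj} denotes the column-determinant of the (n−1)×(n−1) matrix obtained from τ + E[−1] by deleting row j and column j. -/

import Mathlib

open scoped BigOperators

/-- Generators of the Lie algebra `L`: the elements `e_{ij}[r]`, the central
element `K` and the element `τ`. -/
inductive AffGen (n : ℕ) : Type
  | E : Fin n → Fin n → ℤ → AffGen n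
  | K : AffGen n
  | T : AffGen n

/-- The defining relations of the universal enveloping algebra `U(L)`:
`K` is central, `[τ, e_{ij}[r]] = -r e_{ij}[r-1]`, `[τ, K] = 0`, and
`[e_{ij}[r], e_{kl}[s]] = δ_{kj} e_{il}[r+s] - δ_{il} e_{kj}[r+s]
  + r δ_{r,-s} (δ_{kj} δ_{il} - δ_{ij} δ_{kl}/n) K`. -/
inductive AffRel (n : ℕ) :
    FreeAlgebra ℂ (AffGen n) → FreeAlgebra ℂ (AffGen n) → Prop
  | KE (i j : Fin n) (r : ℤ) :
      AffRel n (FreeAlgebra.ι ℂ (AffGen.K : AffGen n) * FreeAlgebra.ι ℂ (AffGen.E i j r))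
            (FreeAlgebra.ι ℂ (AffGen.E i j r) * FreeAlgebra.ι ℂ (AffGen.K : AffGen n))
  | KT :
      AffRel n (FreeAlgebra.ι ℂ (AffGen.K : AffGen n) * FreeAlgebra.ι ℂ (AffGen.T : AffGen n))
            (FreeAlgebra.ι ℂ (AffGen.T : AffGen n) * FreeAlgebra.ι ℂ (AffGen.K : AffGen n))
  | TE (i j : Fin n) (r : ℤ) :
      AffRel n (FreeAlgebra.ι ℂ (AffGen.T : AffGen n) * FreeAlgebra.ι ℂ (AffGen.E i j r)
              - FreeAlgebra.ι ℂ (AffGen.E i j r) * FreeAlgebra.ι ℂ (AffGen.T : AffGen n))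
            ((-r : ℂ) • FreeAlgebra.ι ℂ (AffGen.E i j (r - 1)))
  | EE (i j k l : Fin n) (r s : ℤ) :
      AffRel n (FreeAlgebra.ι ℂ (AffGen.E i j r) * FreeAlgebra.ι ℂ (AffGen.E k l s)
              - FreeAlgebra.ι ℂ (AffGen.E k l s) * FreeAlgebra.ι ℂ (AffGen.E i j r))
            ((if k = j then FreeAlgebra.ι ℂ (AffGen.E i l (r + s)) else 0)
              - (if i = l then FreeAlgebra.ι ℂ (AffGen.E k j (r + s)) else 0)
              + (((r : ℂ) * (if r = -s then (1 : ℂ) else 0) *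
                    ((if k = j then (1 : ℂ) else 0) * (if i = l then (1 : ℂ) else 0)
                      - (if i = j then (1 : ℂ) else 0) * (if k = l then (1 : ℂ) else 0)
                          / (n : ℂ))) •
                  FreeAlgebra.ι ℂ (AffGen.K : AffGen n)))

/-- The universal enveloping algebra `U = U(L)`. -/
abbrev UEA (n : ℕ) : Type := RingQuot (AffRel n)

/-- The element `e_{ij}[r]` of `U`. -/
noncomputable def eGen (n : ℕ) (i j : Fin n) (r : ℤ) : UEA n :=
  RingQuot.mkAlgHom ℂ (AffRel n) (FreeAlgebra.ι ℂ (AffGen.E i j r))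

/-- The central element `K` of `U`. -/
noncomputable def KGen (n : ℕ) : UEA n :=
  RingQuot.mkAlgHom ℂ (AffRel n) (FreeAlgebra.ι ℂ (AffGen.K : AffGen n))

/-- The element `τ` of `U`. -/
noncomputable def tauGen (n : ℕ) : UEA n :=
  RingQuot.mkAlgHom ℂ (AffRel n) (FreeAlgebra.ι ℂ (AffGen.T : AffGen n))

/-- The column-determinant of a matrix over a (noncommutative) ring:
`cdet A = Σ_σ sgn σ · a_{σ(1)1} a_{σ(2)2} ⋯ a_{σ(n)n}`, factors ordered by
column index. -/
noncomputable def cdet {R : Type*} [Ring R] {n : ℕ} (A : Matrix (Fin n) (Fin n) R) : R :=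
  ∑ σ : Equiv.Perm (Fin n),
    (Equiv.Perm.sign σ : ℤ) • (List.ofFn fun j : Fin n => A (σ j) j).prod

/-- The matrix `τ + E[-1]`, with `(i,j)` entry `δ_{ij} τ + e_{ij}[-1]`. -/
noncomputable def tauE (n : ℕ) : Matrix (Fin n) (Fin n) (UEA n) :=
  Matrix.of fun i j => (if i = j then tauGen n else 0) + eGen n i j (-1)

/-- The subalgebra `U(g₋)` of `U` generated by the `e_{ij}[r]` with `r < 0`. -/
noncomputable def Uneg (n : ℕ) : Subalgebra ℂ (UEA n) :=
  Algebra.adjoin ℂ {x : UEA n | ∃ i j : Fin n, ∃ r : ℤ, r < 0 ∧ x = eGen n i j r}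

/-- The left ideal `I` of `U` generated by the `e_{ij}[r]` with `r ≥ 0`. -/
noncomputable def Ipos (n : ℕ) : Submodule (UEA n) (UEA n) :=
  Submodule.span (UEA n)
    {x : UEA n | ∃ i j : Fin n, ∃ r : ℤ, 0 ≤ r ∧ x = eGen n i j r}

/-- The left submodule `(K + n)·U + I` of `U` (note `K + n` is central,
so `(K+n)·U = U·(K+n)`). -/
noncomputable def KnI (n : ℕ) : Submodule (UEA n) (UEA n) :=
  Submodule.span (UEA n)
    (insert (KGen n + (n : UEA n))
      {x : UEA n | ∃ i j : Fin n, ∃ r : ℤ, 0 ≤ r ∧ x = eGen n i j r})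

section OrderedProducts

variable {R : Type*} [Ring R]

theorem prod_ofFn_eq_mul_tail {n : ℕ} (f : Fin (n + 1) → R) :
    (List.ofFn f).prod = f 0 * (List.ofFn (Fin.tail f)).prod := by
  rw [List.ofFn_succ, List.prod_cons]
  rfl

theorem prod_ofFn_update_zero {n : ℕ} (f : Fin (n + 1) → R) (x : R) :
    (List.ofFn (Function.update f 0 x)).prod = x * (List.ofFn (Fin.tail f)).prod := by
  rw [prod_ofFn_eq_mul_tail, Fin.tail_update_zero, Function.update_self]

theorem prod_ofFn_update_succ {n : ℕ} (f : Fin (n + 1) → R) (c : Fin n) (x : R) :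
    (List.ofFn (Function.update f c.succ x)).prod =
      f 0 * (List.ofFn (Function.update (Fin.tail f) c x)).prod := by
  rw [prod_ofFn_eq_mul_tail, Fin.tail_update_succ,
    Function.update_of_ne (Fin.succ_ne_zero c).symm]

theorem prod_ofFn_update_add {n : ℕ} (f : Fin n → R) (c : Fin n) (x y : R) :
    (List.ofFn (Function.update f c (x + y))).prod =
      (List.ofFn (Function.update f c x)).prod + (List.ofFn (Function.update f c y)).prod := by
  simpa only [MultilinearMap.mkPiAlgebraFin_apply] using
    (MultilinearMap.mkPiAlgebraFin ℤ n R).map_update_add f c x y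

theorem prod_ofFn_update_zero_right {n : ℕ} (f : Fin n → R) (c : Fin n) :
    (List.ofFn (Function.update f c 0)).prod = 0 := by
  simpa only [MultilinearMap.mkPiAlgebraFin_apply] using
    (MultilinearMap.mkPiAlgebraFin ℤ n R).map_update_zero f c

/-- An entry commuting with all the other factors can be pulled out of an ordered product. -/
theorem prod_ofFn_update_of_commute {n : ℕ} (f : Fin n → R) (c : Fin n) (x : R)
    (hx : ∀ j, Commute x (f j)) :
    (List.ofFn (Function.update f c x)).prod =
      x * (List.ofFn (Function.update f c 1)).prod := by
  induction n with
  | zero => exact c.elim0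
  | succ n ih =>
    cases c using Fin.cases with
    | zero => simp only [prod_ofFn_update_zero, one_mul]
    | succ c =>
      rw [prod_ofFn_update_succ, prod_ofFn_update_succ, ih (Fin.tail f) c fun j => hx j.succ,
        ← mul_assoc, ← mul_assoc, (hx 0).eq]

/-- The Leibniz rule for the commutator with an ordered product. -/
theorem mul_prod_ofFn {n : ℕ} (x : R) (f : Fin n → R) :
    x * (List.ofFn f).prod = (List.ofFn f).prod * x +
      ∑ c, (List.ofFn (Function.update f c (x * f c - f c * x))).prod := by
  induction n with
  | zero => simp
  | succ n ih =>
    rw [Fin.sum_univ_succ, prod_ofFn_eq_mul_tail, prod_ofFn_update_zero]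
    simp only [prod_ofFn_update_succ]
    have h := ih (Fin.tail f)
    simp only [Fin.tail] at h ⊢
    rw [← Finset.mul_sum, mul_assoc, ← sub_eq_iff_eq_add'.2 h]
    noncomm_ring

/-- Modulo a left ideal, an element of the ideal occurring as a factor of an ordered product
acts on the factors to its right by commutators. -/
theorem prod_ofFn_update_sub_sum_mem (I : Submodule R R) {n : ℕ} (f : Fin n → R) (c : Fin n)
    {x : R} (hx : x ∈ I) :
    (List.ofFn (Function.update f c x)).prod -
      ∑ d, (if c < d then (List.ofFn (Function.update (Function.update f c 1) d
        (x * f d - f d * x))).prod else 0) ∈ I := by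
  induction n with
  | zero => exact c.elim0
  | succ n ih =>
    cases c using Fin.cases with
    | zero =>
      rw [Fin.sum_univ_succ, prod_ofFn_update_zero]
      simp only [lt_self_iff_false, if_false, Fin.succ_pos, if_true, zero_add,
        prod_ofFn_update_succ, Fin.tail_update_zero, Function.update_self, one_mul]
      rw [mul_prod_ofFn]
      simp only [Fin.tail, add_sub_cancel_right]
      exact I.smul_mem _ hx
    | succ c =>
      rw [Fin.sum_univ_succ, prod_ofFn_update_succ]
      simp only [Fin.not_lt_zero, if_false, Fin.succ_lt_succ_iff, zero_add,
        prod_ofFn_update_succ, Fin.tail_update_succ,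
        Function.update_of_ne (Fin.succ_ne_zero c).symm]
      have h := I.smul_mem (f 0) (ih (Fin.tail f) c)
      simpa only [smul_eq_mul, mul_sub, Finset.mul_sum, mul_ite, mul_zero, Fin.tail] using h

theorem prod_ofFn_update_one {n : ℕ} (f : Fin (n + 1) → R) (c : Fin (n + 1)) :
    (List.ofFn (Function.update f c 1)).prod = (List.ofFn fun j => f (c.succAbove j)).prod := by
  induction n with
  | zero =>
    obtain rfl : c = 0 := Fin.eq_zero c
    simp
  | succ n ih =>
    cases c using Fin.cases with
    | zero =>
      rw [prod_ofFn_update_zero, one_mul]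
      simp only [Fin.succAbove_zero]
      rfl
    | succ c =>
      rw [prod_ofFn_update_succ, ih, List.ofFn_succ (n := n), List.prod_cons]
      simp [Fin.tail]

theorem prod_map_update_one {ι : Type*} [DecidableEq ι] (f : ι → R) (c : ι) {l : List ι}
    (hl : l.Nodup) :
    (l.map (Function.update f c 1)).prod = ((l.erase c).map f).prod := by
  induction l with
  | nil => simp
  | cons a l ih =>
    rw [List.nodup_cons] at hl
    by_cases h : a = c
    · subst h
      rw [List.erase_cons_head, List.map_cons, List.prod_cons, Function.update_self, one_mul]
      congr 1
      refine List.map_congr_left fun b hb => Function.update_of_ne ?_ _ _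
      rintro rfl
      exact hl.1 hb
    · rw [List.erase_cons_tail (by simpa using h), List.map_cons, List.map_cons, List.prod_cons,
        List.prod_cons, ih hl.2, Function.update_of_ne h]

end OrderedProducts

section Manin

variable {R : Type*} [Ring R] {ι : Type*} [Fintype ι] [DecidableEq ι]

/-- The cross-commutation relations characterising Manin matrices. -/
def IsManin {ι : Type*} (A : Matrix ι ι R) : Prop :=
  ∀ i j p q, A i p * A j q - A j q * A i p = A j p * A i q - A i q * A j p

theorem IsManin.sum_sign_swap {A : Matrix ι ι R} (hA : IsManin A) {p q : ι} (hpq : p ≠ q)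
    {u v : List ι} (hpu : p ∉ u) (hqu : q ∉ u) (hpv : p ∉ v) (hqv : q ∉ v) :
    ∑ σ : Equiv.Perm ι, (Equiv.Perm.sign σ : ℤ) •
        ((u ++ p :: q :: v).map fun j => A (σ j) j).prod =
      ∑ σ : Equiv.Perm ι, (Equiv.Perm.sign σ : ℤ) •
        ((u ++ q :: p :: v).map fun j => A (σ j) j).prod := by
  rw [← sub_eq_zero, ← Finset.sum_sub_distrib]
  refine Finset.sum_involution (fun σ _ => σ * Equiv.swap p q) ?_ ?_ ?_ ?_
  · intro σ _
    have hcongr : ∀ w : List ι, p ∉ w → q ∉ w →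
        (w.map fun j => A (σ (Equiv.swap p q j)) j) = w.map fun j => A (σ j) j := by
      intro w hp hq
      refine List.map_congr_left fun j hj => ?_
      rw [Equiv.swap_apply_of_ne_of_ne]
      · rintro rfl; exact hp hj
      · rintro rfl; exact hq hj
    have h := sub_eq_zero.2 (hA (σ p) (σ q) p q)
    simp only [List.map_append, List.map_cons, List.prod_append, List.prod_cons,
      Equiv.Perm.mul_apply, hcongr u hpu hqu, hcongr v hpv hqv, Equiv.swap_apply_left,
      Equiv.swap_apply_right, Equiv.Perm.sign_mul, Equiv.Perm.sign_swap hpq, mul_neg, mul_one,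
      Units.val_neg, neg_smul]
    generalize (u.map fun j => A (σ j) j).prod = x, (v.map fun j => A (σ j) j).prod = y
    have hxy : x * (A (σ p) p * (A (σ q) q * y)) - x * (A (σ q) q * (A (σ p) p * y)) -
        (x * (A (σ q) p * (A (σ p) q * y)) - x * (A (σ p) q * (A (σ q) p * y))) = 0 := by
      rw [← mul_zero x, ← zero_mul y, ← h]
      noncomm_ring
    rw [← neg_sub', ← sub_eq_add_neg, ← smul_sub, ← smul_sub, ← smul_sub, hxy, smul_zero]
  · intro σ _ _ h
    have := Equiv.congr_fun (mul_eq_left.1 h) p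
    simp [hpq.symm] at this
  · intro σ _
    exact Finset.mem_univ _
  · intro σ _
    simp [mul_assoc]

/-- Reordering the columns of a Manin matrix together with the factors does not change the
column-determinant. -/
theorem IsManin.sum_sign_perm {A : Matrix ι ι R} (hA : IsManin A) {l₁ l₂ : List ι}
    (h : l₁.Perm l₂) : ∀ u : List ι, (u ++ l₁).Nodup →
    ∑ σ : Equiv.Perm ι, (Equiv.Perm.sign σ : ℤ) • ((u ++ l₁).map fun j => A (σ j) j).prod =
      ∑ σ : Equiv.Perm ι, (Equiv.Perm.sign σ : ℤ) •
        ((u ++ l₂).map fun j => A (σ j) j).prod := by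
  induction h with
  | nil => exact fun u _ => rfl
  | cons a _ ih =>
    intro u hu
    simpa using ih (u ++ [a]) (by simpa using hu)
  | swap p q l =>
    intro u hu
    simp only [List.nodup_append, List.nodup_cons, List.mem_cons] at hu
    exact hA.sum_sign_swap (by grind) (by grind) (by grind) (by grind) (by grind)
  | trans h₁ _ ih₁ ih₂ =>
    intro u hu
    exact (ih₁ u hu).trans (ih₂ u ((h₁.append_left u).nodup hu))

/-- In the column-determinant of a Manin matrix, the factor from any column can be moved to
the right. -/
theorem IsManin.cdet_eq_sum_update_one_mul {n : ℕ} {A : Matrix (Fin n) (Fin n) R}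
    (hA : IsManin A) (c : Fin n) :
    ∑ σ : Equiv.Perm (Fin n), (Equiv.Perm.sign σ : ℤ) •
      ((List.ofFn (Function.update (fun j => A (σ j) j) c 1)).prod * A (σ c) c) = cdet A := by
  have h := hA.sum_sign_perm (l₁ := (List.finRange n).erase c ++ [c]) (l₂ := List.finRange n)
    (((List.perm_append_singleton _ _).trans
      (List.perm_cons_erase (List.mem_finRange c)).symm)) []
    (by
      rw [List.nil_append]
      exact ((List.perm_append_singleton _ _).trans
        (List.perm_cons_erase (List.mem_finRange c)).symm).nodup_iff.2 (List.nodup_finRange n))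
  simpa only [List.nil_append, List.map_append, List.map_cons, List.map_nil, List.prod_append,
    List.prod_singleton, ← prod_map_update_one _ c (List.nodup_finRange n), cdet,
    List.ofFn_eq_map] using h

end Manin

section Minors

theorem extendDomain_finSuccAboveEquiv_self {n : ℕ} (π : Equiv.Perm (Fin n)) (c : Fin (n + 1)) :
    π.extendDomain (finSuccAboveEquiv c) c = c :=
  Equiv.Perm.extendDomain_apply_not_subtype (p := fun x => x ≠ c) π _ (not_not.2 rfl)

theorem extendDomain_finSuccAboveEquiv_succAbove {n : ℕ} (π : Equiv.Perm (Fin n)) (c : Fin (n + 1))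
    (j : Fin n) :
    π.extendDomain (finSuccAboveEquiv c) (c.succAbove j) = c.succAbove (π j) :=
  Equiv.Perm.extendDomain_apply_image π (finSuccAboveEquiv c) j

/-- Permutations fixing `c` are permutations of the remaining indices. -/
theorem sum_perm_fixing {M : Type*} [AddCommGroup M] {n : ℕ} (c : Fin (n + 1))
    (F : Equiv.Perm (Fin (n + 1)) → M) :
    ∑ σ, (if σ c = c then (Equiv.Perm.sign σ : ℤ) • F σ else 0) =
      ∑ π : Equiv.Perm (Fin n), (Equiv.Perm.sign π : ℤ) •
        F (π.extendDomain (finSuccAboveEquiv c)) := by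
  rw [← Finset.sum_filter]
  symm
  refine Finset.sum_bij (fun π _ => π.extendDomain (finSuccAboveEquiv c)) ?_ ?_ ?_ ?_
  · intro π _
    exact Finset.mem_filter.2 ⟨Finset.mem_univ _, extendDomain_finSuccAboveEquiv_self π c⟩
  · intro π _ π' _ h
    exact Equiv.Perm.extendDomainHom_injective (finSuccAboveEquiv c) h
  · intro σ hσ
    have hσ' : ∀ x, σ x ≠ c ↔ x ≠ c := by
      intro x
      rw [Finset.mem_filter] at hσ
      conv_lhs => rw [← hσ.2, Ne, σ.injective.eq_iff]
    refine ⟨(finSuccAboveEquiv c).symm.permCongr (σ.subtypePerm hσ'), Finset.mem_univ _, ?_⟩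
    ext1 x
    by_cases hx : x = c
    · rw [hx, extendDomain_finSuccAboveEquiv_self]
      exact (Finset.mem_filter.1 hσ).2.symm
    · rw [Equiv.Perm.extendDomain_apply_subtype (p := fun x => x ≠ c) _ _ hx]
      simp
  · intro π _
    rw [Equiv.Perm.sign_extendDomain]

variable {R : Type*} [Ring R] {n : ℕ}

theorem cdet_submatrix_succAbove (A : Matrix (Fin (n + 1)) (Fin (n + 1)) R) (c : Fin (n + 1)) :
    ∑ σ : Equiv.Perm (Fin (n + 1)), (if σ c = c then (Equiv.Perm.sign σ : ℤ) •
      (List.ofFn (Function.update (fun j => A (σ j) j) c 1)).prod else 0) =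
        cdet (A.submatrix c.succAbove c.succAbove) := by
  rw [sum_perm_fixing c]
  simp only [prod_ofFn_update_one, extendDomain_finSuccAboveEquiv_succAbove]
  rfl

/-- The ordered product along a permutation, with the factor in column `c` deleted and the factor
in column `d` replaced by the argument. -/
def replacedProd (A : Matrix (Fin n) (Fin n) R) (σ : Equiv.Perm (Fin n)) (c d : Fin n) :
    R →+ R where
  toFun x := (List.ofFn (Function.update (Function.update (fun j => A (σ j) j) c 1) d x)).prod
  map_zero' := prod_ofFn_update_zero_right _ _
  map_add' := prod_ofFn_update_add _ _

theorem replacedProd_apply (A : Matrix (Fin n) (Fin n) R) (σ : Equiv.Perm (Fin n)) (c d : Fin n)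
    (x : R) : replacedProd A σ c d x =
      (List.ofFn (Function.update (Function.update (fun j => A (σ j) j) c 1) d x)).prod :=
  rfl

theorem replacedProd_self (A : Matrix (Fin n) (Fin n) R) (σ : Equiv.Perm (Fin n)) {c d : Fin n}
    (hcd : c ≠ d) : replacedProd A σ c d (A (σ d) d) =
      (List.ofFn (Function.update (fun j => A (σ j) j) c 1)).prod := by
  have h : Function.update (Function.update (fun j => A (σ j) j) c 1) d (A (σ d) d) =
      Function.update (fun j => A (σ j) j) c 1 := by
    rw [Function.update_eq_self_iff, Function.update_of_ne hcd.symm]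
  rw [replacedProd_apply, h]

theorem replacedProd_congr (A : Matrix (Fin n) (Fin n) R) {σ π : Equiv.Perm (Fin n)}
    {c d : Fin n} (h : ∀ j, j ≠ c → j ≠ d → σ j = π j) (x : R) :
    replacedProd A σ c d x = replacedProd A π c d x := by
  have h' : Function.update (Function.update (fun j => A (σ j) j) c 1) d x =
      Function.update (Function.update (fun j => A (π j) j) c 1) d x := by
    funext j
    by_cases hjd : j = d
    · rw [hjd, Function.update_self, Function.update_self]
    rw [Function.update_of_ne hjd, Function.update_of_ne hjd]
    by_cases hjc : j = c
    · rw [hjc, Function.update_self, Function.update_self]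
    rw [Function.update_of_ne hjc, Function.update_of_ne hjc, h j hjc hjd]
  rw [replacedProd_apply, replacedProd_apply, h']

theorem IsManin.sum_replacedProd_last {A : Matrix (Fin (n + 1)) (Fin (n + 1)) R} (hA : IsManin A)
    (c : Fin n) :
    ∑ σ : Equiv.Perm (Fin (n + 1)), (if σ (Fin.last n) = Fin.last n then
      (Equiv.Perm.sign σ : ℤ) •
        replacedProd A σ c.castSucc (Fin.last n) (A (σ c.castSucc) c.castSucc) else 0) =
      cdet (A.submatrix (Fin.last n).succAbove (Fin.last n).succAbove) := by
  have hB : IsManin (A.submatrix (Fin.last n).succAbove (Fin.last n).succAbove) :=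
    fun i j p q => hA _ _ _ _
  rw [sum_perm_fixing (Fin.last n), ← hB.cdet_eq_sum_update_one_mul c]
  refine Finset.sum_congr rfl fun π _ => ?_
  have h := extendDomain_finSuccAboveEquiv_succAbove π (Fin.last n)
  simp only [Fin.succAbove_last] at h
  rw [replacedProd_apply, List.ofFn_succ', List.concat_eq_append, List.prod_append,
    List.prod_singleton, Function.update_self, h]
  have hfun : (fun i : Fin n => Function.update (Function.update
      (fun j => A (π.extendDomain (finSuccAboveEquiv (Fin.last n)) j) j) c.castSucc 1)
      (Fin.last n) (A (π c).castSucc c.castSucc) i.castSucc) =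
      Function.update (fun j => A (π j).castSucc j.castSucc) c 1 := by
    funext i
    rw [Function.update_of_ne (Fin.castSucc_lt_last i).ne]
    by_cases hi : i = c
    · subst hi
      simp
    · rw [Function.update_of_ne hi, Function.update_of_ne (by simpa using hi), h]
  rw [hfun]
  simp only [Matrix.submatrix_apply, Fin.succAbove_last]

theorem sum_replacedProd_swap_rows (A : Matrix (Fin n) (Fin n) R) {c d l : Fin n}
    (hcl : c ≠ l) (x : R) :
    ∑ σ : Equiv.Perm (Fin n), (if σ c = l ∧ σ d = c then
      (Equiv.Perm.sign σ : ℤ) • replacedProd A σ c d x else 0) =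
    -∑ σ : Equiv.Perm (Fin n), (if σ c = c ∧ σ d = l then
      (Equiv.Perm.sign σ : ℤ) • replacedProd A σ c d x else 0) := by
  rw [← Finset.sum_neg_distrib]
  refine Fintype.sum_equiv (Equiv.mulLeft (Equiv.swap c l)) _ _ fun σ => ?_
  have h₁ : Equiv.swap c l (σ c) = c ↔ σ c = l := by
    rw [Equiv.swap_apply_eq_iff, Equiv.swap_apply_left]
  have h₂ : Equiv.swap c l (σ d) = l ↔ σ d = c := by
    rw [Equiv.swap_apply_eq_iff, Equiv.swap_apply_right]
  simp only [Equiv.coe_mulLeft, Equiv.Perm.mul_apply, h₁, h₂, Equiv.Perm.sign_mul,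
    Equiv.Perm.sign_swap hcl, neg_mul, one_mul, Units.val_neg, neg_smul]
  split_ifs with h
  · rw [neg_neg, replacedProd_congr A fun j hjc hjd => ?_]
    rw [Equiv.Perm.mul_apply, Equiv.swap_apply_of_ne_of_ne]
    · rw [← h.2]
      exact fun e => hjd (σ.injective e)
    · rw [← h.1]
      exact fun e => hjc (σ.injective e)
  · rw [neg_zero]

theorem sum_replacedProd_swap_cols (A : Matrix (Fin n) (Fin n) R) {c l : Fin n} (hcl : c ≠ l) :
    ∑ σ : Equiv.Perm (Fin n), (if σ c = l then
      (Equiv.Perm.sign σ : ℤ) • replacedProd A σ c l (A (σ l) c) else 0) =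
    -∑ σ : Equiv.Perm (Fin n), (if σ l = l then
      (Equiv.Perm.sign σ : ℤ) • replacedProd A σ c l (A (σ c) c) else 0) := by
  rw [← Finset.sum_neg_distrib]
  refine Fintype.sum_equiv (Equiv.mulRight (Equiv.swap c l)) _ _ fun σ => ?_
  simp only [Equiv.coe_mulRight, Equiv.Perm.mul_apply, Equiv.swap_apply_right,
    Equiv.swap_apply_left, Equiv.Perm.sign_mul, Equiv.Perm.sign_swap hcl, mul_neg, mul_one,
    Units.val_neg, neg_smul]
  split_ifs with h
  · rw [neg_neg, replacedProd_congr A fun j hjc hjl => ?_]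
    rw [Equiv.Perm.mul_apply, Equiv.swap_apply_of_ne_of_ne hjc hjl]
  · rw [neg_zero]

theorem IsManin.sum_replacedProd_commutator_of_lt {A : Matrix (Fin (n + 1)) (Fin (n + 1)) R}
    (hA : IsManin A) (c : Fin n) {d : Fin (n + 1)} (hd : c.castSucc < d) :
    ∑ σ : Equiv.Perm (Fin (n + 1)), (Equiv.Perm.sign σ : ℤ) • replacedProd A σ c.castSucc d
        ((if σ c.castSucc = c.castSucc then
          (if σ d = Fin.last n then A (Fin.last n) d else 0) -
            (if d = Fin.last n then A (σ d) (Fin.last n) else 0) else 0) +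
          (if σ c.castSucc = Fin.last n then
            (if σ d = c.castSucc then A (Fin.last n) d else 0) -
            (if d = Fin.last n then A (σ d) c.castSucc else 0) else 0)) =
      if d = Fin.last n then
        cdet (A.submatrix (Fin.last n).succAbove (Fin.last n).succAbove) -
          cdet (A.submatrix c.castSucc.succAbove c.castSucc.succAbove)
      else 0 := by
  have hcl : c.castSucc ≠ Fin.last n := (Fin.castSucc_lt_last c).ne
  have hrows := sum_replacedProd_swap_rows A (d := d) hcl (A (Fin.last n) d)
  have hcols := sum_replacedProd_swap_cols A hcl
  have hsplit : ∀ σ : Equiv.Perm (Fin (n + 1)),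
      (Equiv.Perm.sign σ : ℤ) • replacedProd A σ c.castSucc d
        ((if σ c.castSucc = c.castSucc then
          (if σ d = Fin.last n then A (Fin.last n) d else 0) -
            (if d = Fin.last n then A (σ d) (Fin.last n) else 0) else 0) +
          (if σ c.castSucc = Fin.last n then
            (if σ d = c.castSucc then A (Fin.last n) d else 0) -
            (if d = Fin.last n then A (σ d) c.castSucc else 0) else 0)) =
      ((if σ c.castSucc = Fin.last n ∧ σ d = c.castSucc then (Equiv.Perm.sign σ : ℤ) •
          replacedProd A σ c.castSucc d (A (Fin.last n) d) else 0) +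
        (if σ c.castSucc = c.castSucc ∧ σ d = Fin.last n then (Equiv.Perm.sign σ : ℤ) •
          replacedProd A σ c.castSucc d (A (Fin.last n) d) else 0)) -
      (if d = Fin.last n then
        (if σ c.castSucc = Fin.last n then (Equiv.Perm.sign σ : ℤ) •
          replacedProd A σ c.castSucc (Fin.last n) (A (σ (Fin.last n)) c.castSucc) else 0) +
        (if σ c.castSucc = c.castSucc then (Equiv.Perm.sign σ : ℤ) •
          replacedProd A σ c.castSucc (Fin.last n) (A (σ (Fin.last n)) (Fin.last n)) else 0)
      else 0) := by
    intro σ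
    by_cases h₁ : σ c.castSucc = c.castSucc
    · by_cases hdl : d = Fin.last n
      · subst hdl
        by_cases h₃ : σ (Fin.last n) = Fin.last n <;> simp [h₁, hcl, h₃]
      · by_cases h₃ : σ d = Fin.last n <;> simp [h₁, hcl, h₃, hdl]
    by_cases h₂ : σ c.castSucc = Fin.last n
    · by_cases hdl : d = Fin.last n
      · subst hdl
        by_cases h₃ : σ (Fin.last n) = c.castSucc <;> simp [h₂, hcl.symm, h₃, mul_sub]
      · by_cases h₃ : σ d = c.castSucc <;> simp [h₂, hcl.symm, h₃, hdl]
    · simp [h₁, h₂]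
  rw [Finset.sum_congr rfl fun σ _ => hsplit σ, Finset.sum_sub_distrib, Finset.sum_add_distrib,
    hrows, neg_add_cancel, zero_sub]
  split_ifs
  · rw [Finset.sum_add_distrib, hcols, hA.sum_replacedProd_last c,
      ← cdet_submatrix_succAbove A c.castSucc]
    simp only [replacedProd_self A _ hcl]
    abel
  · rw [Finset.sum_const_zero, neg_zero]

/-- The commutator terms, summed over all permutations: the contributions of the rows cancel and
the contributions of the last column are principal minors. -/
theorem IsManin.sum_replacedProd_commutator {A : Matrix (Fin (n + 1)) (Fin (n + 1)) R}
    (hA : IsManin A) (c : Fin n) :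
    ∑ σ : Equiv.Perm (Fin (n + 1)), (Equiv.Perm.sign σ : ℤ) •
      ∑ d, (if c.castSucc < d then replacedProd A σ c.castSucc d
        ((if σ c.castSucc = c.castSucc then
          (if σ d = Fin.last n then A (Fin.last n) d else 0) -
            (if d = Fin.last n then A (σ d) (Fin.last n) else 0) else 0) +
          (if σ c.castSucc = Fin.last n then
            (if σ d = c.castSucc then A (Fin.last n) d else 0) -
            (if d = Fin.last n then A (σ d) c.castSucc else 0) else 0)) else 0) =
      cdet (A.submatrix (Fin.last n).succAbove (Fin.last n).succAbove) -
        cdet (A.submatrix c.castSucc.succAbove c.castSucc.succAbove) := by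
  simp only [Finset.smul_sum]
  rw [Finset.sum_comm, Finset.sum_eq_single (Fin.last n)]
  · have hd := Fin.castSucc_lt_last c
    refine (Finset.sum_congr rfl fun σ _ => ?_).trans
      ((hA.sum_replacedProd_commutator_of_lt c hd).trans (if_pos rfl))
    rw [if_pos hd]
  · intro d _ hdl
    by_cases hd : c.castSucc < d
    · simp only [if_pos hd]
      rw [hA.sum_replacedProd_commutator_of_lt c hd, if_neg hdl]
    · simp only [if_neg hd, smul_zero, Finset.sum_const_zero]
  · exact fun h => absurd (Finset.mem_univ _) h

theorem IsManin.sum_sum_replacedProd_commutator {A : Matrix (Fin (n + 1)) (Fin (n + 1)) R}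
    (hA : IsManin A) :
    ∑ σ : Equiv.Perm (Fin (n + 1)), (Equiv.Perm.sign σ : ℤ) • ∑ c, ∑ d, (if c < d then
      replacedProd A σ c d
        ((if σ c = c then
          (if σ d = Fin.last n then A (Fin.last n) d else 0) -
            (if d = Fin.last n then A (σ d) (Fin.last n) else 0) else 0) +
          (if σ c = Fin.last n then
            (if σ d = c then A (Fin.last n) d else 0) -
            (if d = Fin.last n then A (σ d) c else 0) else 0)) else 0) =
      ∑ c : Fin n, (cdet (A.submatrix (Fin.last n).succAbove (Fin.last n).succAbove) -
        cdet (A.submatrix c.castSucc.succAbove c.castSucc.succAbove)) := by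
  rw [Finset.sum_congr rfl fun σ _ => Finset.smul_sum, Finset.sum_comm, Fin.sum_univ_castSucc]
  rw [Finset.sum_congr rfl fun c _ => hA.sum_replacedProd_commutator c]
  simp [fun d : Fin (n + 1) => (Fin.le_last d).not_gt]

end Minors

section Assembly

variable {R : Type*} [Ring R] [Algebra ℂ R] {n : ℕ}

theorem sum_sign_smul_sum_fixed (A : Matrix (Fin (n + 1)) (Fin (n + 1)) R) (k : R)
    (a : Fin (n + 1) → ℂ) :
    ∑ σ : Equiv.Perm (Fin (n + 1)), (Equiv.Perm.sign σ : ℤ) • ∑ c, (if σ c = c then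
      a c • (k * (List.ofFn (Function.update (fun j => A (σ j) j) c 1)).prod) else 0) =
      ∑ c, a c • (k * cdet (A.submatrix c.succAbove c.succAbove)) := by
  simp only [Finset.smul_sum]
  rw [Finset.sum_comm]
  refine Finset.sum_congr rfl fun c _ => ?_
  rw [← cdet_submatrix_succAbove, Finset.mul_sum, Finset.smul_sum]
  refine Finset.sum_congr rfl fun σ _ => ?_
  by_cases h : σ c = c
  · rw [if_pos h, if_pos h, mul_smul_comm, smul_comm]
  · rw [if_neg h, if_neg h, mul_zero, smul_zero, smul_zero]

/-- Summing over all permutations the action of `x` on the terms of the column-determinant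
expresses the action on the column-determinant by principal minors. -/
theorem IsManin.mul_cdet_sub_mem {A : Matrix (Fin (n + 1)) (Fin (n + 1)) R} (hA : IsManin A)
    (I : Submodule R R) (x k : R) (a : Fin (n + 1) → ℂ)
    (h : ∀ σ : Equiv.Perm (Fin (n + 1)), x * (List.ofFn fun j => A (σ j) j).prod -
      (∑ c, (if σ c = c then
          a c • (k * (List.ofFn (Function.update (fun j => A (σ j) j) c 1)).prod) else 0) +
        ∑ c, ∑ d, (if c < d then replacedProd A σ c d
          ((if σ c = c then
            (if σ d = Fin.last n then A (Fin.last n) d else 0) -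
              (if d = Fin.last n then A (σ d) (Fin.last n) else 0) else 0) +
            (if σ c = Fin.last n then
              (if σ d = c then A (Fin.last n) d else 0) -
              (if d = Fin.last n then A (σ d) c else 0) else 0)) else 0)) ∈ I) :
    x * cdet A - (∑ c, a c • (k * cdet (A.submatrix c.succAbove c.succAbove)) +
      ∑ c : Fin n, (cdet (A.submatrix (Fin.last n).succAbove (Fin.last n).succAbove) -
        cdet (A.submatrix c.castSucc.succAbove c.castSucc.succAbove))) ∈ I := by
  have hsum := sum_mem (t := Finset.univ) fun (σ : Equiv.Perm (Fin (n + 1))) _ =>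
    zsmul_mem (h σ) (Equiv.Perm.sign σ : ℤ)
  simp only [smul_sub _ (x * _), smul_add, Finset.sum_sub_distrib, Finset.sum_add_distrib] at hsum
  rw [sum_sign_smul_sum_fixed] at hsum
  rw [Finset.sum_congr rfl fun σ _ => (mul_smul_comm _ x _).symm, ← Finset.mul_sum] at hsum
  rw [← hA.sum_sum_replacedProd_commutator]
  exact hsum

theorem sum_smul_add_sum_sub_eq (k : R) (M : Fin (n + 1) → R) :
    ∑ c, ((if c = Fin.last n then 1 else 0) - ((n + 1 : ℕ) : ℂ)⁻¹) • (k * M c) +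
        ∑ c : Fin n, (M (Fin.last n) - M c.castSucc) =
      ((n + 1 : ℂ))⁻¹ • ((k + ((n + 1 : ℕ) : R)) *
        ((n : R) * M (Fin.last n) - ∑ i : Fin n, M i.castSucc)) := by
  have hcast : ∀ m : ℕ, (m : R) = (m : ℂ) • 1 := fun m => by
    rw [Nat.cast_smul_eq_nsmul, nsmul_one]
  have hn0 : (n : ℂ) + 1 ≠ 0 := by exact_mod_cast n.succ_ne_zero
  have hnsmul : n • M (Fin.last n) = (n : ℂ) • M (Fin.last n) :=
    (Nat.cast_smul_eq_nsmul ℂ n _).symm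
  rw [Fin.sum_univ_castSucc]
  simp only [(Fin.castSucc_lt_last _).ne, if_true, if_false, ← Finset.smul_sum, ← Finset.mul_sum,
    Finset.sum_sub_distrib, Finset.sum_const, Finset.card_univ, Fintype.card_fin, hcast, hnsmul,
    smul_mul_assoc, one_mul, add_mul, mul_sub, mul_smul_comm]
  generalize ∑ i : Fin n, M i.castSucc = S
  match_scalars <;> field_simp <;> ring

end Assembly

section Affine

theorem KGen_mul_eGen (n : ℕ) (i j : Fin n) (r : ℤ) :
    KGen n * eGen n i j r = eGen n i j r * KGen n := by
  simpa only [KGen, eGen, map_mul] using RingQuot.mkAlgHom_rel ℂ (AffRel.KE i j r)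

theorem KGen_mul_tauGen (n : ℕ) : KGen n * tauGen n = tauGen n * KGen n := by
  simpa only [KGen, tauGen, map_mul] using RingQuot.mkAlgHom_rel ℂ (AffRel.KT (n := n))

theorem tauGen_commutator (n : ℕ) (i j : Fin n) (r : ℤ) :
    tauGen n * eGen n i j r - eGen n i j r * tauGen n = (-r : ℂ) • eGen n i j (r - 1) := by
  simpa only [tauGen, eGen, map_mul, map_sub, map_smul] using
    RingQuot.mkAlgHom_rel ℂ (AffRel.TE i j r)

theorem eGen_commutator (n : ℕ) (i j k l : Fin n) (r s : ℤ) :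
    eGen n i j r * eGen n k l s - eGen n k l s * eGen n i j r =
      (if k = j then eGen n i l (r + s) else 0) - (if i = l then eGen n k j (r + s) else 0) +
        ((r : ℂ) * (if r = -s then (1 : ℂ) else 0) *
          ((if k = j then (1 : ℂ) else 0) * (if i = l then (1 : ℂ) else 0) -
            (if i = j then (1 : ℂ) else 0) * (if k = l then (1 : ℂ) else 0) / (n : ℂ))) •
          KGen n := by
  simpa only [KGen, eGen, map_mul, map_sub, map_add, map_smul,
    apply_ite (RingQuot.mkAlgHom ℂ (AffRel n)), map_zero] using
    RingQuot.mkAlgHom_rel ℂ (AffRel.EE i j k l r s)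

theorem KGen_commute_tauE (n : ℕ) (i j : Fin n) : Commute (KGen n) (tauE n i j) := by
  rw [tauE, Matrix.of_apply]
  refine Commute.add_right ?_ (KGen_mul_eGen n i j (-1))
  split_ifs
  · exact KGen_mul_tauGen n
  · exact Commute.zero_right _

theorem isManin_tauE (n : ℕ) : IsManin (tauE n) := by
  have htau : ∀ i j p q : Fin n, (if i = p then tauGen n else 0) * eGen n j q (-1) -
      eGen n j q (-1) * (if i = p then tauGen n else 0) =
        if i = p then eGen n j q (-2) else 0 := by
    intro i j p q
    have h := tauGen_commutator n j q (-1)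
    norm_num at h
    split_ifs
    · exact h
    · simp
  have hentry : ∀ i j p q : Fin n, tauE n i p * tauE n j q - tauE n j q * tauE n i p =
      (if i = p then eGen n j q (-2) else 0) - (if j = q then eGen n i p (-2) else 0) +
        ((if j = p then eGen n i q (-2) else 0) - (if i = q then eGen n j p (-2) else 0)) := by
    intro i j p q
    have he := eGen_commutator n i p j q (-1) (-1)
    norm_num at he
    have hcomm : (if i = p then tauGen n else 0) * (if j = q then tauGen n else 0) -
        (if j = q then tauGen n else 0) * (if i = p then tauGen n else 0) = 0 := by
      split_ifs <;> simp
    rw [← he, ← htau i j p q, ← htau j i q p]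
    have hexpand : ∀ s t x y : UEA n, (s + x) * (t + y) - (t + y) * (s + x) =
        (s * t - t * s) + ((s * y - y * s) - (t * x - x * t) + (x * y - y * x)) := by
      intro s t x y
      noncomm_ring
    simp only [tauE, Matrix.of_apply]
    rw [hexpand, hcomm, zero_add]
  intro i j p q
  rw [hentry, hentry]
  abel

theorem eGen_zero_commutator_tauE (n : ℕ) (a b k d : Fin n) :
    eGen n a b 0 * tauE n k d - tauE n k d * eGen n a b 0 =
      (if k = b then tauE n a d else 0) - (if d = a then tauE n k b else 0) := by
  have he := eGen_commutator n a b k d 0 (-1)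
  have ht : tauGen n * eGen n a b 0 - eGen n a b 0 * tauGen n = 0 := by
    simpa using tauGen_commutator n a b 0
  have ht' : (if k = d then tauGen n else 0) * eGen n a b 0 -
      eGen n a b 0 * (if k = d then tauGen n else 0) = 0 := by
    split_ifs
    · exact ht
    · simp
  norm_num at he
  have hsplit : eGen n a b 0 * tauE n k d - tauE n k d * eGen n a b 0 =
      (if k = b then eGen n a d (-1) else 0) - (if a = d then eGen n k b (-1) else 0) := by
    rw [← he, ← sub_zero (eGen n a b 0 * eGen n k d (-1) - _), ← ht']
    simp only [tauE, Matrix.of_apply]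
    noncomm_ring
  rw [hsplit]
  simp only [tauE, Matrix.of_apply]
  by_cases hkb : k = b <;> by_cases had : d = a <;> simp [hkb, had, eq_comm (a := a)]

theorem eGen_one_commutator_tauE (n : ℕ) (l k c : Fin n) :
    eGen n l l 1 * tauE n k c - tauE n k c * eGen n l l 1 =
      ((if k = c then eGen n l l 0 else 0) + (if k = l then eGen n l c 0 else 0) -
        (if c = l then eGen n k l 0 else 0)) +
      (if k = c then ((if c = l then 1 else 0) - (n : ℂ)⁻¹) • KGen n else 0) := by
  have he := eGen_commutator n l l k c 1 (-1)
  have ht := tauGen_commutator n l l 1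
  norm_num at he ht
  have ht' : (if k = c then tauGen n else 0) * eGen n l l 1 -
      eGen n l l 1 * (if k = c then tauGen n else 0) = -(if k = c then eGen n l l 0 else 0) := by
    split_ifs
    · exact ht
    · simp
  have hsplit : eGen n l l 1 * tauE n k c - tauE n k c * eGen n l l 1 =
      (eGen n l l 1 * eGen n k c (-1) - eGen n k c (-1) * eGen n l l 1) -
      ((if k = c then tauGen n else 0) * eGen n l l 1 -
      eGen n l l 1 * (if k = c then tauGen n else 0)) := by
    simp only [tauE, Matrix.of_apply]
    noncomm_ring
  rw [hsplit, ht', he]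
  by_cases hkc : k = c
  · subst hkc
    by_cases hkl : k = l <;> simp [hkl, eq_comm (a := l), add_comm]
  · by_cases hkl : k = l
    · subst hkl
      simp [hkc, Ne.symm hkc]
    · by_cases hcl : c = l <;> simp [hkc, hkl, hcl, eq_comm (a := l)]

theorem eGen_zero_mem_Ipos {n : ℕ} (i j : Fin n) : eGen n i j 0 ∈ Ipos n :=
  Submodule.subset_span ⟨i, j, 0, le_rfl, rfl⟩

theorem eGen_one_mem_Ipos {n : ℕ} (i j : Fin n) : eGen n i j 1 ∈ Ipos n :=
  Submodule.subset_span ⟨i, j, 1, zero_le_one, rfl⟩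

/-- The action of `e_{nn}[1]` on a single summand of the column-determinant, modulo `Ipos`. -/
theorem eGen_one_mul_prod_sub_mem (n : ℕ) (σ : Equiv.Perm (Fin (n + 1))) :
    eGen (n + 1) (Fin.last n) (Fin.last n) 1 * (List.ofFn fun j => tauE (n + 1) (σ j) j).prod -
      (∑ c, (if σ c = c then ((if c = Fin.last n then 1 else 0) - ((n + 1 : ℕ) : ℂ)⁻¹) •
          (KGen (n + 1) *
            (List.ofFn (Function.update (fun j => tauE (n + 1) (σ j) j) c 1)).prod) else 0) +
        ∑ c, ∑ d, (if c < d then replacedProd (tauE (n + 1)) σ c d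
          ((if σ c = c then
            (if σ d = Fin.last n then tauE (n + 1) (Fin.last n) d else 0) -
              (if d = Fin.last n then tauE (n + 1) (σ d) (Fin.last n) else 0) else 0) +
            (if σ c = Fin.last n then
              (if σ d = c then tauE (n + 1) (Fin.last n) d else 0) -
              (if d = Fin.last n then tauE (n + 1) (σ d) c else 0) else 0)) else 0)) ∈
      Ipos (n + 1) := by
  rw [mul_prod_ofFn, add_sub_assoc, ← Finset.sum_add_distrib, ← Finset.sum_sub_distrib]
  refine add_mem (Submodule.smul_mem _ _ (eGen_one_mem_Ipos _ _)) (sum_mem fun c _ => ?_)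
  set x : UEA (n + 1) := (if σ c = c then eGen (n + 1) (Fin.last n) (Fin.last n) 0 else 0) +
    (if σ c = Fin.last n then eGen (n + 1) (Fin.last n) c 0 else 0) -
    (if c = Fin.last n then eGen (n + 1) (σ c) (Fin.last n) 0 else 0) with hxdef
  have hx : x ∈ Ipos (n + 1) := by
    refine sub_mem (add_mem ?_ ?_) ?_ <;> split_ifs <;>
      first | exact eGen_zero_mem_Ipos _ _ | exact zero_mem _
  have hK : (List.ofFn (Function.update (fun j => tauE (n + 1) (σ j) j) c
      (if σ c = c then ((if c = Fin.last n then 1 else 0) - ((n + 1 : ℕ) : ℂ)⁻¹) • KGen (n + 1)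
        else 0))).prod =
      if σ c = c then ((if c = Fin.last n then 1 else 0) - ((n + 1 : ℕ) : ℂ)⁻¹) •
        (KGen (n + 1) *
          (List.ofFn (Function.update (fun j => tauE (n + 1) (σ j) j) c 1)).prod) else 0 := by
    rw [prod_ofFn_update_of_commute]
    · by_cases h : σ c = c
      · rw [if_pos h, if_pos h, smul_mul_assoc]
      · rw [if_neg h, if_neg h, zero_mul]
    · intro j
      by_cases h : σ c = c
      · rw [if_pos h]
        exact (KGen_commute_tauE _ _ _).smul_left _
      · rw [if_neg h]
        exact Commute.zero_left _
  rw [eGen_one_commutator_tauE, ← hxdef, prod_ofFn_update_add, hK,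
    add_comm (List.prod _), add_sub_add_left_eq_sub]
  convert prod_ofFn_update_sub_sum_mem _ (fun j => tauE (n + 1) (σ j) j) c hx using 5 with d _ hcd
  rw [replacedProd_apply]
  have hcl : c ≠ Fin.last n := (hcd.trans_le (Fin.le_last d)).ne
  have hcomm : x * tauE (n + 1) (σ d) d - tauE (n + 1) (σ d) d * x =
      (if σ c = c then
        (if σ d = Fin.last n then tauE (n + 1) (Fin.last n) d else 0) -
          (if d = Fin.last n then tauE (n + 1) (σ d) (Fin.last n) else 0) else 0) +
      (if σ c = Fin.last n then
        (if σ d = c then tauE (n + 1) (Fin.last n) d else 0) -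
          (if d = Fin.last n then tauE (n + 1) (σ d) c else 0) else 0) := by
    rw [← eGen_zero_commutator_tauE, ← eGen_zero_commutator_tauE, hxdef, if_neg hcl]
    by_cases h₁ : σ c = c
    · simp [h₁, hcl]
    · by_cases h₂ : σ c = Fin.last n <;> simp [h₂, h₁, hcl.symm]
  rw [hcomm]

end Affine

/-- The matrix size is `n + 1` (the paper's `n` is `n + 1 ≥ 2`),
the last index being `Fin.last n`.  Then
`e_{nn}[1] · cdet(τ + E[-1]) - (1/n)(K + n)·((n-1)|τ+E[-1]|_{nn} - Σ_{i=1}^{n-1} |τ+E[-1]|_{ii})`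
lies in the left ideal `I`, where `|τ+E[-1]|_{jj}` is the column-determinant of
the minor with row and column `j` deleted (here the paper's `n - 1` is `n`, the
paper's `1/n` is `1/(n+1)`, and `K + n` is `KGen + (n+1)`). -/
theorem e_nn_one_mul_cdet (n : ℕ) (hn : 1 ≤ n) :
    eGen (n + 1) (Fin.last n) (Fin.last n) 1 * cdet (tauE (n + 1))
      - ((n + 1 : ℂ))⁻¹ •
          ((KGen (n + 1) + ((n + 1 : ℕ) : UEA (n + 1))) *
            ((n : UEA (n + 1)) *
                cdet ((tauE (n + 1)).submatrix
                  (Fin.last n).succAbove (Fin.last n).succAbove)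
              - ∑ i : Fin n,
                  cdet ((tauE (n + 1)).submatrix
                    i.castSucc.succAbove i.castSucc.succAbove)))
      ∈ Ipos (n + 1) := by
  have h := (isManin_tauE (n + 1)).mul_cdet_sub_mem (Ipos (n + 1)) _ _ _
    (eGen_one_mul_prod_sub_mem n)
  have hM := sum_smul_add_sum_sub_eq (KGen (n + 1)) fun c =>
    cdet ((tauE (n + 1)).submatrix c.succAbove c.succAbove)
  exact hM ▸ h
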